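/- arXiv:math/0110211 — 2 statements merged into one kernel-verified Lean document; each statement's English description precedes it below -/
import Mathlib

section
/- Let C be a convergent chip firing game with initial configuration σ₀, let τ be a configuration reachable from σ₀, let F be the set of vertices firable in τ, and let τ_F be the configuration obtained from τ by firing all vertices of F (in any order). Then the map sending a subset X ⊆ F to the configuration obtained from τ by firing the vertices of X is an order isomorphism from the powerset of F, ordered by inclusion, onto the interval [τ, τ_F] of the configuration space ordered by reachability. In particular the configuration space of a convergent CFG is upper locally distributive. -/
/-- A chip firing game over vertex set `V` is given by an edge-multiplicity
function `E : V → V → ℕ`; `outdeg E v` is the out-degree of `v`. -/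
def outdeg {V : Type*} [Fintype V] (E : V → V → ℕ) (v : V) : ℕ := ∑ w, E v w

/-- A vertex `v` is firable in the configuration `σ` if it holds at least
as many chips as its out-degree. -/
def Firable {V : Type*} [Fintype V] (E : V → V → ℕ) (σ : V → ℕ) (v : V) : Prop :=
  outdeg E v ≤ σ v

/-- Firing the vertex `v` in the configuration `σ`. -/
def fire {V : Type*} [Fintype V] [DecidableEq V] (E : V → V → ℕ) (σ : V → ℕ) (v : V) :
    V → ℕ :=
  fun w => σ w + E v w - (if w = v then outdeg E v else 0)

/-- The configuration obtained from `σ` by firing the vertices of a list, in order. -/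
def fireList {V : Type*} [Fintype V] [DecidableEq V] (E : V → V → ℕ) :
    (V → ℕ) → List V → (V → ℕ)
  | σ, [] => σ
  | σ, v :: l => fireList E (fire E σ v) l

/-- A list of vertices is a valid firing sequence from `σ` if each vertex is
firable at the moment it is fired. -/
def ValidSeq {V : Type*} [Fintype V] [DecidableEq V] (E : V → V → ℕ) :
    (V → ℕ) → List V → Prop
  | _, [] => True
  | σ, v :: l => Firable E σ v ∧ ValidSeq E (fire E σ v) l

/-- `τ` is reachable from `σ` if some valid firing sequence leads from `σ` to `τ`. -/
def Reachable {V : Type*} [Fintype V] [DecidableEq V] (E : V → V → ℕ) (σ τ : V → ℕ) : Prop :=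
  ∃ l : List V, ValidSeq E σ l ∧ fireList E σ l = τ

/-- A CFG with initial configuration `σ₀` is convergent if some configuration with
no firable vertex is reachable from `σ₀`. -/
def Convergent {V : Type*} [Fintype V] [DecidableEq V] (E : V → V → ℕ) (σ₀ : V → ℕ) : Prop :=
  ∃ τ, Reachable E σ₀ τ ∧ ∀ v, ¬ Firable E τ v

/-- A CFG is simple if in every firing sequence starting from the initial
configuration, each vertex is fired at most once. -/
def SimpleCFG {V : Type*} [Fintype V] [DecidableEq V] (E : V → V → ℕ) (σ₀ : V → ℕ) : Prop :=
  ∀ l : List V, ValidSeq E σ₀ l → l.Nodup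

section ChipFiring

variable {V : Type*} [Fintype V] [DecidableEq V] {E : V → V → ℕ}

theorem Firable.fire_of_ne {σ : V → ℕ} {u v : V} (hu : Firable E σ u) (huv : u ≠ v) :
    Firable E (fire E σ v) u := by
  simp only [Firable, fire, if_neg huv] at *
  omega

theorem fire_comm {σ : V → ℕ} {u v : V} (hu : Firable E σ u) (hv : Firable E σ v) :
    fire E (fire E σ u) v = fire E (fire E σ v) u := by
  ext w
  simp only [Firable, fire] at *
  split_ifs <;> subst_vars <;> omega

theorem fireList_append (σ : V → ℕ) (l m : List V) :
    fireList E σ (l ++ m) = fireList E (fireList E σ l) m := by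
  induction l generalizing σ with
  | nil => rfl
  | cons v l ih => exact ih _

theorem validSeq_append {σ : V → ℕ} {l m : List V} :
    ValidSeq E σ (l ++ m) ↔ ValidSeq E σ l ∧ ValidSeq E (fireList E σ l) m := by
  induction l generalizing σ with
  | nil => simp [ValidSeq, fireList]
  | cons v l ih => simp [ValidSeq, fireList, ih, and_assoc]

theorem Firable.fireList_of_notMem {σ : V → ℕ} {v : V} {l : List V} (hv : Firable E σ v)
    (hl : v ∉ l) : Firable E (fireList E σ l) v := by
  induction l generalizing σ with
  | nil => exact hv
  | cons u l ih =>
    rw [List.mem_cons, not_or] at hl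
    exact ih (hv.fire_of_ne hl.1) hl.2

theorem ValidSeq.erase {σ : V → ℕ} {v : V} {l : List V} (hl : ValidSeq E σ l)
    (hv : Firable E σ v) (hvl : v ∈ l) : ValidSeq E (fire E σ v) (l.erase v) := by
  induction l generalizing σ with
  | nil => simp at hvl
  | cons u l ih =>
    obtain ⟨hu, hl⟩ := hl
    by_cases huv : u = v
    · subst huv
      simpa using hl
    · rw [List.erase_cons_tail (by simpa using huv)]
      refine ⟨hu.fire_of_ne huv, ?_⟩
      rw [fire_comm hv hu]
      exact ih hl (hv.fire_of_ne (Ne.symm huv))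
        ((List.mem_cons.1 hvl).resolve_left (Ne.symm huv))

theorem ValidSeq.fireList_apply {σ : V → ℕ} {l : List V} (hl : ValidSeq E σ l) (w : V) :
    (fireList E σ l w : ℤ) =
      σ w + (l.map fun v => (E v w : ℤ) - if w = v then (outdeg E v : ℤ) else 0).sum := by
  induction l generalizing σ with
  | nil => simp [fireList]
  | cons v l ih =>
    obtain ⟨hv, hl⟩ := hl
    have h : (fire E σ v w : ℤ) =
        σ w + ((E v w : ℤ) - if w = v then (outdeg E v : ℤ) else 0) := by
      simp only [Firable, fire] at *
      split_ifs <;> subst_vars <;> omega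
    simp only [fireList, ih hl, h, List.map_cons, List.sum_cons]
    ring

theorem ValidSeq.fireList_eq_of_perm {σ : V → ℕ} {l m : List V} (hl : ValidSeq E σ l)
    (hm : ValidSeq E σ m) (h : l.Perm m) : fireList E σ l = fireList E σ m := by
  ext w
  have := (h.map fun v => (E v w : ℤ) - if w = v then (outdeg E v : ℤ) else 0).sum_eq
  zify
  rw [hl.fireList_apply, hm.fireList_apply, this]

theorem validSeq_of_nodup {σ : V → ℕ} {l : List V} (hl : l.Nodup)
    (h : ∀ v ∈ l, Firable E σ v) : ValidSeq E σ l := by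
  induction l generalizing σ with
  | nil => trivial
  | cons v l ih =>
    rw [List.nodup_cons] at hl
    refine ⟨h v (by simp), ih hl.2 fun u hu => ?_⟩
    exact (h u (by simp [hu])).fire_of_ne fun huv => hl.1 (huv ▸ hu)

/-- The least action principle: a valid firing sequence uses each vertex at most as often as
any valid firing sequence that ends in a stable configuration. -/
theorem ValidSeq.subperm_of_stable {σ : V → ℕ} {l m : List V} (hl : ValidSeq E σ l)
    (hm : ValidSeq E σ m) (hstable : ∀ v, ¬ Firable E (fireList E σ m) v) : l.Subperm m := by
  induction l generalizing σ m with
  | nil => exact m.nil_subperm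
  | cons v l ih =>
    obtain ⟨hv, hl⟩ := hl
    have hvm : v ∈ m := by
      by_contra h
      exact hstable v (hv.fireList_of_notMem h)
    have hm' := hm.erase hv hvm
    have hperm := List.perm_cons_erase hvm
    have heq : fireList E σ m = fireList E (fire E σ v) (m.erase v) :=
      hm.fireList_eq_of_perm (m := v :: m.erase v) ⟨hv, hm'⟩ hperm
    have := ih hl hm' (heq ▸ hstable)
    exact (List.subperm_cons v |>.2 this).trans hperm.symm.subperm

/-- Every configuration reachable in a convergent game can still be stabilized. -/
theorem Convergent.of_reachable {σ τ : V → ℕ} (hσ : Convergent E σ) (h : Reachable E σ τ) :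
    Convergent E τ := by
  obtain ⟨_, ⟨m, hm, rfl⟩, hstable⟩ := hσ
  obtain ⟨l, hl, rfl⟩ := h
  induction l generalizing σ m with
  | nil => exact ⟨_, ⟨m, hm, rfl⟩, hstable⟩
  | cons v l ih =>
    obtain ⟨hv, hl⟩ := hl
    have hvm : v ∈ m := by
      by_contra h
      exact hstable v (hv.fireList_of_notMem h)
    have hm' := hm.erase hv hvm
    have heq : fireList E σ m = fireList E (fire E σ v) (m.erase v) :=
      hm.fireList_eq_of_perm (m := v :: m.erase v) ⟨hv, hm'⟩ (List.perm_cons_erase hvm)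
    exact ih _ hm' (heq ▸ hstable) hl

/-- In a convergent game, the firing sequences between two configurations all fire each vertex
equally often. -/
theorem Convergent.perm_of_fireList_eq {σ : V → ℕ} {l m : List V} (hσ : Convergent E σ)
    (hl : ValidSeq E σ l) (hm : ValidSeq E σ m) (h : fireList E σ l = fireList E σ m) :
    l.Perm m := by
  obtain ⟨_, ⟨n, hn, rfl⟩, hstable⟩ := hσ.of_reachable ⟨l, hl, rfl⟩
  have hln : ValidSeq E σ (l ++ n) := validSeq_append.2 ⟨hl, hn⟩
  have hmn : ValidSeq E σ (m ++ n) := validSeq_append.2 ⟨hm, h ▸ hn⟩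
  refine (List.perm_append_right_iff n).1 (List.Subperm.antisymm ?_ ?_)
  · exact hln.subperm_of_stable hmn (by rwa [fireList_append, ← h])
  · exact hmn.subperm_of_stable hln (by rwa [fireList_append])

/-- For sets of firable vertices, inclusion is the same as reachability of the configurations
obtained by firing them. -/
theorem Convergent.subset_iff_reachable {σ : V → ℕ} {l m : List V} (hσ : Convergent E σ)
    (hl : l.Nodup) (hm : m.Nodup) (hlσ : ∀ v ∈ l, Firable E σ v)
    (hmσ : ∀ v ∈ m, Firable E σ v) :
    l ⊆ m ↔ Reachable E (fireList E σ l) (fireList E σ m) := by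
  have hvl := validSeq_of_nodup hl hlσ
  have hvm := validSeq_of_nodup hm hmσ
  constructor
  · intro h
    have hperm : (l ++ m.diff l).Perm m := List.subperm_append_diff_self_of_count_le
      (List.subperm_ext_iff.1 (hl.subperm h))
    have hv : ValidSeq E σ (l ++ m.diff l) :=
      validSeq_of_nodup (hperm.nodup_iff.2 hm) fun v hv => hmσ v (hperm.subset hv)
    exact ⟨m.diff l, (validSeq_append.1 hv).2, by
      rw [← fireList_append, hv.fireList_eq_of_perm hvm hperm]⟩
  · rintro ⟨n, hn, h⟩
    rw [← fireList_append] at h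
    exact List.Subset.trans (List.subset_append_left l n)
      (hσ.perm_of_fireList_eq (validSeq_append.2 ⟨hvl, hn⟩) hvm h).subset

end ChipFiring

/-- let `τ` be reachable in a convergent CFG, `F` the set of vertices firable
in `τ`, and `τF` the configuration obtained from `τ` by firing all vertices of `F` (in any
order, here along the enumeration `lF`).  Then the map sending a subset `X ⊆ F` to the
configuration obtained from `τ` by firing the vertices of `X` (in any order) is an order
isomorphism from the powerset of `F`, ordered by inclusion, onto the interval `[τ, τF]` of
the configuration space ordered by reachability. -/
theorem powerset_orderIso_interval {V : Type*} [Fintype V] [DecidableEq V]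
    (E : V → V → ℕ) (σ₀ τ : V → ℕ) (hconv : Convergent E σ₀) (hτ : Reachable E σ₀ τ)
    (F : Finset V) (hF : ∀ v, v ∈ F ↔ Firable E τ v)
    (τF : V → ℕ) (lF : List V) (hlF : lF.Nodup) (hlFF : lF.toFinset = F)
    (hτF : fireList E τ lF = τF) :
    ∃ e : {X : Finset V // X ⊆ F} ≃ {σ : V → ℕ // Reachable E τ σ ∧ Reachable E σ τF},
      (∀ (X : {X : Finset V // X ⊆ F}) (l : List V), l.Nodup → l.toFinset = X.val →
        (e X).val = fireList E τ l) ∧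
      (∀ X Y : {X : Finset V // X ⊆ F}, X.val ⊆ Y.val ↔ Reachable E (e X).val (e Y).val) := by
  have hconvτ := hconv.of_reachable hτ
  have hlF' : ∀ v ∈ lF, Firable E τ v := fun v hv =>
    (hF v).1 (hlFF ▸ List.mem_toFinset.2 hv)
  have hX : ∀ X : {X : Finset V // X ⊆ F}, ∀ v ∈ X.val.toList, Firable E τ v := fun X v hv =>
    (hF v).1 (X.2 (Finset.mem_toList.1 hv))
  have hmono : ∀ X Y : {X : Finset V // X ⊆ F}, X.val ⊆ Y.val ↔
      Reachable E (fireList E τ X.val.toList) (fireList E τ Y.val.toList) := fun X Y => by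
    rw [← hconvτ.subset_iff_reachable (Finset.nodup_toList _) (Finset.nodup_toList _)
      (hX X) (hX Y)]
    simp only [List.subset_def, Finset.mem_toList, Finset.subset_iff]
  have hfire : ∀ (X : {X : Finset V // X ⊆ F}) (l : List V), l.Nodup → l.toFinset = X.val →
      fireList E τ X.val.toList = fireList E τ l := fun X l hl hlX => by
    have hperm : X.val.toList.Perm l :=
      (List.perm_ext_iff_of_nodup (Finset.nodup_toList _) hl).2 fun v => by simp [← hlX]
    exact (validSeq_of_nodup (Finset.nodup_toList _) (hX X)).fireList_eq_of_perm
      (validSeq_of_nodup hl fun v hv => hX X v (hperm.mem_iff.2 hv)) hperm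
  let f : {X : Finset V // X ⊆ F} → {σ : V → ℕ // Reachable E τ σ ∧ Reachable E σ τF} :=
    fun X => ⟨fireList E τ X.val.toList,
      ⟨_, validSeq_of_nodup (Finset.nodup_toList _) (hX X), rfl⟩, by
        rw [← hτF, ← hconvτ.subset_iff_reachable (Finset.nodup_toList _) hlF (hX X) hlF']
        intro v hv
        exact List.mem_toFinset.1 (hlFF ▸ X.2 (Finset.mem_toList.1 hv))⟩
  have hf : Function.Bijective f := by
    constructor
    · intro X Y h
      have h' : fireList E τ X.val.toList = fireList E τ Y.val.toList := congrArg Subtype.val h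
      exact Subtype.ext (subset_antisymm ((hmono X Y).2 (h' ▸ ⟨[], trivial, rfl⟩))
        ((hmono Y X).2 (h' ▸ ⟨[], trivial, rfl⟩)))
    · rintro ⟨_, ⟨l, hl, rfl⟩, m, hm, h⟩
      rw [← fireList_append, ← hτF] at h
      have hperm := hconvτ.perm_of_fireList_eq (validSeq_append.2 ⟨hl, hm⟩)
        (validSeq_of_nodup hlF hlF') h
      have hsub : l.toFinset ⊆ F := fun v hv => by
        rw [← hlFF, List.mem_toFinset]
        exact hperm.subset (List.mem_append_left _ (List.mem_toFinset.1 hv))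
      exact ⟨⟨l.toFinset, hsub⟩,
        Subtype.ext (hfire _ l (List.Nodup.of_append_left (hperm.nodup_iff.2 hlF)) rfl)⟩
  exact ⟨Equiv.ofBijective f hf, hfire, hmono⟩
end

section
/- In a finite upper locally distributive lattice L, for every join-irreducible element j of L there is exactly one meet-irreducible element m of L such that j ↕ m. Consequently, the set of join-irreducibles of L is partitioned into the sets m_↕ = {j join-irreducible : j ↕ m}, for m ranging over the meet-irreducibles. -/
/-- An element of a lattice is join-irreducible if it has exactly one lower cover. -/
def JoinIrred {L : Type*} [Lattice L] (j : L) : Prop := ∃! a : L, a ⋖ j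

/-- An element of a lattice is meet-irreducible if it has exactly one upper cover. -/
def MeetIrred {L : Type*} [Lattice L] (m : L) : Prop := ∃! b : L, m ⋖ b

open Classical in
/-- The join of all upper covers of `x` (equal to `x` itself when `x` has no upper
cover). -/
noncomputable def covJoin {L : Type*} [Lattice L] [Fintype L] (x : L) : L :=
  (insert x (Finset.univ.filter (fun y => x ⋖ y))).sup' (Finset.insert_nonempty _ _) id

/-- A finite lattice is upper locally distributive (ULD) if for every `x`, the interval
between `x` and the join of all upper covers of `x` is order-isomorphic to the powerset
(ordered by inclusion) of the set of upper covers of `x`. -/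
def IsULD (L : Type*) [Lattice L] [Fintype L] : Prop :=
  ∀ x : L, Nonempty ((Set.Icc x (covJoin x)) ≃o Set {y : L // x ⋖ y})

/-- `UpDown j m` is the relation `j ↕ m`: `j ≰ m`, `j⁻ ≤ m` (every lower cover of `j`
is below `m`) and `j ≤ m⁺` (`j` is below every upper cover of `m`). -/
def UpDown {L : Type*} [Lattice L] (j m : L) : Prop :=
  ¬ j ≤ m ∧ (∀ a : L, a ⋖ j → a ≤ m) ∧ (∀ b : L, m ⋖ b → j ≤ b)

/-- Each interval from `x` to the join of its upper covers is distributive. -/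
theorem IsULD.inf_sup_le {L : Type*} [Lattice L] [Fintype L] (hULD : IsULD L) {x p q r : L}
    (hp : x ≤ p) (hq : x ≤ q) (hr : x ≤ r) (hp' : p ≤ covJoin x) (hq' : q ≤ covJoin x)
    (hr' : r ≤ covJoin x) : p ⊓ (q ⊔ r) ≤ (p ⊓ q) ⊔ (p ⊓ r) := by
  obtain ⟨φ⟩ := hULD x
  let P : Set.Icc x (covJoin x) := ⟨p, hp, hp'⟩
  let Q : Set.Icc x (covJoin x) := ⟨q, hq, hq'⟩
  let R : Set.Icc x (covJoin x) := ⟨r, hr, hr'⟩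
  have h : P ⊓ (Q ⊔ R) ≤ (P ⊓ Q) ⊔ (P ⊓ R) := by
    rw [← φ.le_iff_le]
    simp only [map_inf, map_sup]
    exact inf_sup_left _ _ _ |>.le
  exact h

theorem CovBy.le_covJoin {L : Type*} [Lattice L] [Fintype L] {x y : L} (h : x ⋖ y) :
    y ≤ covJoin x := by
  classical
  exact Finset.le_sup' (f := id) (by simp [h])

theorem CovBy.inf_eq_of_not_le {L : Type*} [Lattice L] {x y t : L} (h : x ⋖ y) (ht : x ≤ t)
    (hyt : ¬ y ≤ t) : y ⊓ t = x :=
  (h.eq_or_eq (le_inf h.le ht) inf_le_left).resolve_right fun e => hyt (inf_eq_left.1 e)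

theorem CovBy.eq_of_le_of_covBy {L : Type*} [Lattice L] {x y t : L} (h : x ⋖ y) (ht : x ⋖ t)
    (hyt : y ≤ t) : y = t :=
  (ht.eq_or_eq h.le hyt).resolve_left h.ne'

theorem IsULD.covBy_sup {L : Type*} [Lattice L] [Fintype L] (hULD : IsULD L) {x u v : L}
    (hu : x ⋖ u) (hv : x ⋖ v) (huv : u ≠ v) : u ⋖ u ⊔ v := by
  refine ⟨left_lt_sup.2 fun h => huv (hv.eq_of_le_of_covBy hu h).symm, fun t hut ht => ?_⟩
  have hvt : ¬ v ≤ t := fun h => ht.not_ge (sup_le hut.le h)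
  have hxt : x ≤ t := hu.le.trans hut.le
  have hd := hULD.inf_sup_le hxt hu.le hv.le
    (ht.le.trans (sup_le hu.le_covJoin hv.le_covJoin)) hu.le_covJoin hv.le_covJoin
  rw [inf_eq_left.2 ht.le, inf_comm t v, hv.inf_eq_of_not_le hxt hvt] at hd
  exact hut.not_ge (hd.trans (sup_le inf_le_right hu.le))

/-- The only upper covers of `x` below the join of two upper covers are those two. -/
theorem IsULD.eq_or_eq_of_le_sup {L : Type*} [Lattice L] [Fintype L] (hULD : IsULD L)
    {x u v w : L} (hu : x ⋖ u) (hv : x ⋖ v) (hw : x ⋖ w) (h : w ≤ u ⊔ v) : w = u ∨ w = v := by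
  by_contra! hne
  have hd := hULD.inf_sup_le hw.le hu.le hv.le hw.le_covJoin hu.le_covJoin hv.le_covJoin
  rw [inf_eq_left.2 h,
    hw.inf_eq_of_not_le hu.le fun e => hne.1 (hw.eq_of_le_of_covBy hu e),
    hw.inf_eq_of_not_le hv.le fun e => hne.2 (hw.eq_of_le_of_covBy hv e), sup_idem] at hd
  exact hw.lt.not_ge hd

/-- Finite upper locally distributive lattices are upper semimodular. -/
theorem IsULD.covBy_sup_of_covBy {L : Type*} [Lattice L] [Fintype L] (hULD : IsULD L)
    {a b z : L} (hab : a ⋖ b) (haz : a ≤ z) (hbz : ¬ b ≤ z) : z ⋖ z ⊔ b := by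
  induction a using WellFoundedGT.induction generalizing b with
  | ind a ih =>
    obtain rfl | hlt := haz.eq_or_lt
    · rwa [sup_eq_right.2 hab.le]
    · obtain ⟨c, hac, hcz⟩ := exists_covBy_le_of_lt hlt
      have hcb : c ≠ b := fun e => hbz (e ▸ hcz)
      have := ih c hac.lt (hULD.covBy_sup hac hab hcb) hcz fun e => hbz (le_sup_right.trans e)
      rwa [← sup_assoc, sup_eq_left.2 hcz] at this

/-- If `a ⋖ j`, the elements above `a` but not above `j` are closed under joins. -/
theorem IsULD.not_le_sup {L : Type*} [Lattice L] [Fintype L] (hULD : IsULD L)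
    {a j x y : L} (haj : a ⋖ j) (hx : a ≤ x) (hy : a ≤ y) (hjx : ¬ j ≤ x) (hjy : ¬ j ≤ y) :
    ¬ j ≤ x ⊔ y := by
  suffices H : ∀ z, a ≤ z → ∀ x y, z ≤ x → z ≤ y → ¬ j ≤ x → ¬ j ≤ y → ¬ j ≤ x ⊔ y from
    H a le_rfl x y hx hy hjx hjy
  clear x y hx hy hjx hjy
  intro z
  induction z using WellFoundedGT.induction with
  | ind z ih =>
    intro haz x y hzx hzy hjx hjy
    obtain rfl | hltx := hzx.eq_or_lt
    · rwa [sup_eq_right.2 hzy]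
    obtain rfl | hlty := hzy.eq_or_lt
    · rwa [sup_eq_left.2 hzx]
    obtain ⟨u, hzu, hux⟩ := exists_covBy_le_of_lt hltx
    obtain ⟨v, hzv, hvy⟩ := exists_covBy_le_of_lt hlty
    have hju : ¬ j ≤ u := fun e => hjx (e.trans hux)
    have hjv : ¬ j ≤ v := fun e => hjy (e.trans hvy)
    have hjuv : ¬ j ≤ u ⊔ v := fun e => by
      have hzj := hULD.covBy_sup_of_covBy haj haz fun e => hjx (e.trans hzx)
      rcases hULD.eq_or_eq_of_le_sup hzu hzv hzj
        (sup_le (hzu.le.trans le_sup_left) e) with e | e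
      · exact hju (e ▸ le_sup_right)
      · exact hjv (e ▸ le_sup_right)
    have hau := haz.trans hzu.le
    have hav := haz.trans hzv.le
    have h₁ := ih u hzu.lt hau x (u ⊔ v) hux le_sup_left hjx hjuv
    have h₂ := ih v hzv.lt hav y (u ⊔ v) hvy le_sup_right hjy hjuv
    have h₃ := ih u hzu.lt hau _ _ (hux.trans le_sup_left)
      (le_sup_left.trans le_sup_right) h₁ h₂
    exact fun e => h₃ (e.trans (sup_le_sup le_sup_left le_sup_left))

theorem IsULD.existsUnique_upDown {L : Type*} [Lattice L] [Fintype L] (hULD : IsULD L) {j : L}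
    (hj : JoinIrred j) : ∃! m : L, MeetIrred m ∧ UpDown j m := by
  obtain ⟨a, haj, ha⟩ := hj
  obtain ⟨m, ⟨ham, hjm⟩, hmax⟩ := (Set.toFinite {x : L | a ≤ x ∧ ¬ j ≤ x}).exists_maximal
    ⟨a, le_rfl, haj.lt.not_ge⟩
  have hcov : ∀ b, m ⋖ b → j ≤ b := fun b hb => by
    by_contra hjb
    exact hb.lt.not_ge (hmax ⟨ham.trans hb.le, hjb⟩ hb.le)
  refine ⟨m, ⟨⟨m ⊔ j, hULD.covBy_sup_of_covBy haj ham hjm, fun b hb => ?_⟩, hjm,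
    fun c hc => ha c hc ▸ ham, hcov⟩, ?_⟩
  · exact (hULD.covBy_sup_of_covBy haj ham hjm).eq_of_le_of_covBy hb
      (sup_le hb.le (hcov b hb)) |>.symm
  · rintro m' ⟨-, hjm', hm', hcov'⟩
    have hm'm : m' ≤ m := le_sup_right.trans
      (hmax ⟨ham.trans le_sup_left, hULD.not_le_sup haj ham (hm' a haj) hjm hjm'⟩ le_sup_left)
    by_contra hne
    obtain ⟨b, hb, hbm⟩ := exists_covBy_le_of_lt (hm'm.lt_of_ne hne)
    exact hjm ((hcov' b hb).trans hbm)

/-- in a finite ULD lattice, every join-irreducible `j` has exactly one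
meet-irreducible `m` with `j ↕ m`; consequently the join-irreducibles are partitioned
into the sets `m_↕ = {j join-irreducible | j ↕ m}` for `m` meet-irreducible. -/
theorem joinIrred_unique_upDown {L : Type*} [Lattice L] [Fintype L] (hULD : IsULD L) :
    (∀ j : L, JoinIrred j → ∃! m : L, MeetIrred m ∧ UpDown j m) ∧
    ({j : L | JoinIrred j} =
      ⋃ m ∈ {m : L | MeetIrred m}, {j : L | JoinIrred j ∧ UpDown j m}) ∧
    (∀ m m' : L, MeetIrred m → MeetIrred m' → m ≠ m' →
      Disjoint {j : L | JoinIrred j ∧ UpDown j m} {j : L | JoinIrred j ∧ UpDown j m'}) := by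
  refine ⟨fun j hj => hULD.existsUnique_upDown hj, ?_, fun m m' hm hm' hne => ?_⟩
  · ext j
    simp only [Set.mem_ofPred_eq, Set.mem_iUnion, exists_prop]
    refine ⟨fun hj => ?_, fun ⟨_, _, hj, _⟩ => hj⟩
    obtain ⟨m, ⟨hm, hjm⟩, -⟩ := hULD.existsUnique_upDown hj
    exact ⟨m, hm, hj, hjm⟩
  · rw [Set.disjoint_left]
    rintro j ⟨hj, hjm⟩ ⟨-, hjm'⟩
    exact hne ((hULD.existsUnique_upDown hj).unique ⟨hm, hjm⟩ ⟨hm', hjm'⟩)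
end
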